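/- arXiv:1902.05229 — 2 statements merged into one kernel-verified Lean document; each statement's English description precedes it below -/
import Mathlib

section
/- Let X be a compact Hausdorff topological space and let A be a norm-bounded subset of the Banach space C(X, ℝ) of continuous real-valued functions on X with the supremum norm. If A has RSC (every sequence in A has a subsequence that converges pointwise to some real-valued function on X) and A has SCP (the pointwise limit of every pointwise convergent sequence from A is a continuous function on X), then A is relatively weakly compact in C(X, ℝ) (i.e., the closure of A in the weak topology of C(X, ℝ) is weakly compact). -/
/-- A family `A` of continuous real-valued functions on `X` has RSC (relative
sequential compactness in `ℝ^X`) if every sequence in `A` has a subsequence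
converging pointwise to some real-valued function on `X`. -/
def HasRSC {X : Type*} [TopologicalSpace X] (A : Set C(X, ℝ)) : Prop :=
  ∀ u : ℕ → C(X, ℝ), (∀ n, u n ∈ A) →
    ∃ φ : ℕ → ℕ, StrictMono φ ∧ ∃ f : X → ℝ,
      ∀ x, Filter.Tendsto (fun k => u (φ k) x) Filter.atTop (nhds (f x))

/-- A family `A` of continuous real-valued functions on `X` has SCP (weak
sequential completeness property) if the pointwise limit of every pointwise
convergent sequence from `A` is continuous. -/
def HasSCP {X : Type*} [TopologicalSpace X] (A : Set C(X, ℝ)) : Prop :=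
  ∀ u : ℕ → C(X, ℝ), (∀ n, u n ∈ A) → ∀ f : X → ℝ,
    (∀ x, Filter.Tendsto (fun n => u n x) Filter.atTop (nhds (f x))) →
      Continuous f

open Filter Topology

lemma zero_of_norm_le {V : Type*} [NormedAddCommGroup V] (v : V)
    (h : ∀ ε : ℝ, 0 < ε → ‖v‖ ≤ ε) : v = 0 := by
  rw [← norm_eq_zero]
  exact le_antisymm (le_of_forall_gt_imp_ge_of_dense h) (norm_nonneg _)

lemma norming {V : Type*} [NormedAddCommGroup V] [NormedSpace ℝ V]
    (G : Submodule ℝ (StrongDual ℝ V)) (hG : G.FG) :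
    ∃ S : Finset V, (∀ v ∈ S, ‖v‖ ≤ 1) ∧ ∀ φ ∈ G, ∃ v ∈ S, ‖φ‖ ≤ 2 * |φ v| := by
  classical
  have : FiniteDimensional ℝ G := Module.Finite.iff_fg.2 hG
  have : ProperSpace G := FiniteDimensional.proper ℝ G
  have hK : IsCompact (Metric.sphere (0 : G) 1) := isCompact_sphere 0 1
  obtain ⟨t, ht⟩ := hK.elim_finite_subcover
    (fun v : Metric.closedBall (0 : V) 1 => {ψ : G | 1 / 2 < |(ψ : StrongDual ℝ V) v|})
    (fun v => by
      refine isOpen_lt continuous_const ?_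
      refine continuous_abs.comp ?_
      exact (((ContinuousLinearMap.apply ℝ ℝ (v : V)).continuous).comp continuous_subtype_val))
    (by
      intro ψ hψ
      have h1 : ‖(ψ : StrongDual ℝ V)‖ = 1 := mem_sphere_zero_iff_norm.1 hψ
      obtain ⟨x, hx, hx2⟩ := (ψ : StrongDual ℝ V).exists_lt_apply_of_lt_opNorm
        (r := 1 / 2) (by rw [h1]; norm_num)
      exact Set.mem_iUnion.2 ⟨⟨x, by simpa using hx.le⟩, hx2⟩)
  refine ⟨insert 0 (t.image Subtype.val), ?_, ?_⟩
  · intro v hv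
    rcases Finset.mem_insert.1 hv with rfl | hv
    · simp
    · obtain ⟨w, -, rfl⟩ := Finset.mem_image.1 hv
      exact mem_closedBall_zero_iff.1 w.2
  · intro φ hφ
    by_cases h0 : φ = 0
    · exact ⟨0, by simp, by simp [h0]⟩
    have hn : 0 < ‖φ‖ := norm_pos_iff.2 h0
    have hs : (‖φ‖⁻¹ • (⟨φ, hφ⟩ : G)) ∈ Metric.sphere (0 : G) 1 := by
      refine (mem_sphere_zero_iff_norm (E := G)).2 ?_
      change ‖‖φ‖⁻¹ • φ‖ = 1
      rw [norm_smul, norm_inv, norm_norm]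
      exact inv_mul_cancel₀ hn.ne'
    obtain ⟨v, hv, hv2⟩ := Set.mem_iUnion₂.1 (ht hs)
    refine ⟨v, by simp only [Finset.mem_insert, Finset.mem_image]; exact Or.inr ⟨v, hv, rfl⟩, ?_⟩
    have hv3 : 1 / 2 < ‖φ‖⁻¹ * |φ v| := by
      simpa [abs_mul, abs_of_pos hn] using hv2
    have : ‖φ‖ * (1 / 2) < ‖φ‖ * (‖φ‖⁻¹ * |φ v|) := by gcongr
    rw [← mul_assoc, mul_inv_cancel₀ hn.ne'] at this
    linarith

open NormedSpace in
/-- Eberlein-Smulian (one direction), after Whitley. -/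
lemma eberlein {E : Type*} [NormedAddCommGroup E] [NormedSpace ℝ E]
    (A : Set E) (hbdd : Bornology.IsBounded A)
    (hseq : ∀ u : ℕ → E, (∀ n, u n ∈ A) → ∃ φ : ℕ → ℕ, StrictMono φ ∧ ∃ x : E,
      ∀ l : StrongDual ℝ E, Tendsto (fun k => l (u (φ k))) atTop (𝓝 (l x))) :
    IsCompact (closure (toWeakSpace ℝ E '' A)) := by
  classical
  refine isCompact_closure_of_isBounded ℝ E _
    (by rwa [Set.preimage_image_eq _ (toWeakSpace ℝ E).injective]) ?_
  intro F₀ hF₀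
  let F : StrongDual ℝ (StrongDual ℝ E) := WeakDual.toStrongDual F₀
  let J := inclusionInDoubleDual ℝ E
  -- approximation
  have happ : ∀ (S : Finset (StrongDual ℝ E)) (ε : ℝ), 0 < ε →
      ∃ a ∈ A, ∀ l ∈ S, |F l - l a| < ε := by
    intro S ε hε
    have hU : IsOpen {H : WeakDual ℝ (StrongDual ℝ E) | ∀ l ∈ S, |F l - H l| < ε} := by
      have : {H : WeakDual ℝ (StrongDual ℝ E) | ∀ l ∈ S, |F l - H l| < ε} =
        ⋂ l ∈ S, {H : WeakDual ℝ (StrongDual ℝ E) | |F l - H l| < ε} := by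
        ext; simp
      rw [this]
      refine isOpen_biInter_finset fun l _ => ?_
      exact isOpen_lt (continuous_abs.comp
        (continuous_const.sub (WeakDual.eval_continuous l))) continuous_const
    obtain ⟨H, hH, hH2⟩ := mem_closure_iff.1 hF₀ _ hU (by
      intro l _
      change |F₀ l - F₀ l| < ε
      simpa using hε)
    obtain ⟨_, ⟨a, ha, rfl⟩, rfl⟩ := hH2
    exact ⟨a, ha, hH⟩
  let T := E × (Submodule ℝ (StrongDual ℝ (StrongDual ℝ E))) × Finset (StrongDual ℝ E) × ℕ
  let P : T → Prop := fun y => y.1 ∈ A ∧ y.2.1.FG ∧ F ∈ y.2.1 ∧ J y.1 ∈ y.2.1 ∧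
    (∀ v ∈ y.2.2.1, ‖v‖ ≤ 1) ∧ ∀ φ ∈ y.2.1, ∃ v ∈ y.2.2.1, ‖φ‖ ≤ 2 * |φ v|
  let r : T → T → Prop := fun x y => x.2.1 ≤ y.2.1 ∧ x.2.2.2 < y.2.2.2 ∧
    ∀ l ∈ x.2.2.1, |F l - l y.1| < 1 / ((y.2.2.2 : ℝ) + 1)
  obtain ⟨f, hP, hr⟩ := exists_seq_of_forall_finset_exists P r (by
    intro s hs
    let k : ℕ := s.sup (fun y => y.2.2.2) + 1
    obtain ⟨a, ha, ha2⟩ := happ (s.biUnion fun y => y.2.2.1) (1 / ((k : ℝ) + 1)) (by positivity)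
    let G : Submodule ℝ (StrongDual ℝ (StrongDual ℝ E)) :=
      (s.sup fun y => y.2.1) ⊔ Submodule.span ℝ {F, J a}
    have h3 : G.FG := by
      refine Submodule.FG.sup ?_ (Submodule.fg_span (by simp))
      rw [Finset.sup_eq_iSup]
      exact Submodule.fg_biSup s _ fun y hy => (hs y hy).2.1
    obtain ⟨S, hS1, hS2⟩ := norming G h3
    refine ⟨(a, G, S, k), ⟨ha, h3, ?_, ?_, hS1, hS2⟩, ?_⟩
    · exact Submodule.mem_sup_right (Submodule.subset_span (by simp))
    · exact Submodule.mem_sup_right (Submodule.subset_span (by simp))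
    · intro x hx
      refine ⟨le_trans (Finset.le_sup (f := fun y : T => y.2.1) hx) le_sup_left, ?_, ?_⟩
      · exact Nat.lt_succ_of_le (Finset.le_sup (f := fun y : T => y.2.2.2) hx)
      · intro l hl
        exact ha2 l (Finset.mem_biUnion.2 ⟨x, hx, hl⟩))
  obtain ⟨φ, hφ, x, hx⟩ := hseq (fun n => (f n).1) (fun n => (hP n).1)
  have hk : StrictMono fun n => (f n).2.2.2 := fun m n h => (hr m n h).2.1
  have hGm : Monotone fun n => (f n).2.1 := by
    intro m n h
    rcases h.eq_or_lt with rfl | h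
    · exact le_rfl
    · exact (hr m n h).1
  -- vanishing
  have hvan : ∀ m, ∀ l ∈ (f m).2.2.1, F l = l x := by
    intro m l hl
    have h1 : Tendsto (fun n => l (f n).1) atTop (𝓝 (F l)) := by
      rw [tendsto_iff_dist_tendsto_zero]
      refine squeeze_zero' (g := fun n : ℕ => 1 / ((n : ℝ) + 1))
        (Eventually.of_forall fun n => dist_nonneg) ?_ tendsto_one_div_add_atTop_nhds_zero_nat
      filter_upwards [eventually_gt_atTop m] with n hn
      have := (hr m n hn).2.2 l hl
      rw [dist_comm, Real.dist_eq]
      refine this.le.trans ?_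
      have : (n : ℝ) ≤ (f n).2.2.2 := by exact_mod_cast hk.le_apply (x := n)
      gcongr
    exact tendsto_nhds_unique (h1.comp hφ.tendsto_atTop) (hx l)
  -- closure
  have hcl : x ∈ closure ((Submodule.span ℝ (Set.range fun n => (f n).1) : Submodule ℝ E) : Set E) := by
    by_contra hx'
    obtain ⟨g, c, hg1, hg2⟩ := geometric_hahn_banach_closed_point
      (Submodule.span ℝ (Set.range fun n => (f n).1)).topologicalClosure.convex
      (Submodule.isClosed_topologicalClosure _) hx'
    have : g x ≤ c := le_of_tendsto (hx g) (Eventually.of_forall fun k =>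
      (hg1 _ (subset_closure (Submodule.subset_span ⟨_, rfl⟩))).le)
    linarith
  have hspan : ∀ y ∈ Submodule.span ℝ (Set.range fun n => (f n).1), ∃ n, J y ∈ (f n).2.1 := by
    intro y hy
    induction hy using Submodule.span_induction with
    | mem y hy => obtain ⟨n, rfl⟩ := hy; exact ⟨n, (hP n).2.2.2.1⟩
    | zero => exact ⟨0, by simp⟩
    | add y z _ _ hy hz =>
      obtain ⟨m, hm⟩ := hy
      obtain ⟨n, hn⟩ := hz
      refine ⟨max m n, ?_⟩
      rw [map_add]
      exact Submodule.add_mem _ (hGm (le_max_left m n) hm) (hGm (le_max_right m n) hn)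
    | smul c y _ hy =>
      obtain ⟨m, hm⟩ := hy
      exact ⟨m, by rw [map_smul]; exact Submodule.smul_mem _ _ hm⟩
  have hFJ : F - J x = 0 := by
    refine zero_of_norm_le (V := StrongDual ℝ (StrongDual ℝ E)) (F - J x) fun ε hε => ?_
    obtain ⟨y, hy, hxy⟩ := Metric.mem_closure_iff.1 hcl (ε / 3) (by positivity)
    obtain ⟨n, hn⟩ := hspan y hy
    obtain ⟨v, hv, hv2⟩ := (hP n).2.2.2.2.2 (F - J y) (Submodule.sub_mem _ (hP n).2.2.1 hn)
    have hv1 := (hP n).2.2.2.2.1 v hv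
    have hF := hvan n v hv
    have e1 : (F - J y) v = v (x - y) := by
      change F v - v y = v (x - y)
      rw [hF, map_sub]
    have e2 : |v (x - y)| ≤ ‖x - y‖ := by
      refine (v.le_opNorm _).trans ?_
      exact mul_le_of_le_one_left (norm_nonneg _) hv1
    have e3 : ‖F - J x‖ ≤ ‖F - J y‖ + ‖x - y‖ := by
      have : F - J x = (F - J y) - J (x - y) := by rw [map_sub]; abel
      rw [this]
      exact (norm_sub_le (E := StrongDual ℝ (StrongDual ℝ E)) (F - J y) (J (x - y))).trans
        (add_le_add le_rfl (double_dual_bound ℝ E _))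
    rw [dist_eq_norm] at hxy
    rw [e1] at hv2
    linarith
  refine ⟨toWeakSpace ℝ E x, ?_⟩
  have : F = J x := sub_eq_zero.1 hFJ
  exact this.symm


open scoped NNReal CompactlySupported in
lemma exists_variation {X : Type*} [TopologicalSpace X] [CompactSpace X]
    (L : StrongDual ℝ C(X, ℝ)) :
    ∃ Λ : C_c(X, ℝ≥0) →ₗ[ℝ≥0] ℝ≥0, ∀ (f : C_c(X, ℝ≥0)) (g : C(X, ℝ)),
      (∀ x, |g x| ≤ f x) → L g ≤ Λ f := by
  let W : C_c(X, ℝ≥0) → Set ℝ := fun f => {r | ∃ g : C(X, ℝ), (∀ x, |g x| ≤ f x) ∧ L g = r}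
  have h0 : ∀ f, (0 : ℝ) ∈ W f := fun f => ⟨0, by simp, by simp⟩
  have hb : ∀ f, BddAbove (W f) := by
    intro f
    let F : C(X, ℝ) := ⟨fun x => (f x : ℝ), by fun_prop⟩
    refine ⟨‖L‖ * ‖F‖, ?_⟩
    rintro _ ⟨g, hg, rfl⟩
    refine (le_abs_self _).trans ((L.le_opNorm g).trans ?_)
    gcongr
    rw [ContinuousMap.norm_le _ (norm_nonneg _)]
    intro x
    exact (hg x).trans ((le_abs_self _).trans (F.norm_coe_le_norm x))
  have hle : ∀ f (g : C(X, ℝ)), (∀ x, |g x| ≤ f x) → L g ≤ sSup (W f) :=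
    fun f g hg => le_csSup (hb f) ⟨g, hg, rfl⟩
  have hub : ∀ f c, (∀ g : C(X, ℝ), (∀ x, |g x| ≤ f x) → L g ≤ c) → sSup (W f) ≤ c := by
    intro f c h
    refine csSup_le ⟨0, h0 f⟩ ?_
    rintro _ ⟨g, hg, rfl⟩
    exact h g hg
  have hnn : ∀ f, 0 ≤ sSup (W f) := fun f => le_csSup (hb f) (h0 f)
  have hadd : ∀ f₁ f₂, sSup (W (f₁ + f₂)) = sSup (W f₁) + sSup (W f₂) := by
    intro f₁ f₂
    apply le_antisymm
    · refine hub _ _ fun g hg => ?_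
      let g₁ : C(X, ℝ) := ⟨fun x => max (-(f₁ x : ℝ)) (min (f₁ x : ℝ) (g x)), by fun_prop⟩
      have e : L g = L g₁ + L (g - g₁) := by rw [← map_add]; congr 1; abel
      rw [e]
      refine add_le_add (hle _ _ fun x => ?_) (hle _ _ fun x => ?_)
      · have := (f₁ x).2
        change |max (-(f₁ x : ℝ)) (min (f₁ x : ℝ) (g x))| ≤ (f₁ x : ℝ)
        rw [abs_le]
        exact ⟨le_max_left _ _, max_le (by linarith [(f₁ x).coe_nonneg]) (min_le_left _ _)⟩
      · change |g x - max (-(f₁ x : ℝ)) (min (f₁ x : ℝ) (g x))| ≤ (f₂ x : ℝ)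
        have h1 := hg x
        have h2 := (f₁ x).coe_nonneg
        have h3 := (f₂ x).coe_nonneg
        simp only [CompactlySupportedContinuousMap.coe_add, Pi.add_apply, NNReal.coe_add] at h1
        rw [abs_le] at h1 ⊢
        rcases max_cases (-(f₁ x : ℝ)) (min (f₁ x : ℝ) (g x)) with h | h <;>
        rcases min_cases (f₁ x : ℝ) (g x) with h' | h' <;> constructor <;> linarith
    · rw [← le_sub_iff_add_le]
      refine hub _ _ fun g₁ hg₁ => ?_
      rw [le_sub_comm]
      refine hub _ _ fun g₂ hg₂ => ?_
      rw [le_sub_iff_add_le, add_comm, ← map_add]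
      refine hle _ _ fun x => ?_
      simp only [CompactlySupportedContinuousMap.coe_add, Pi.add_apply, NNReal.coe_add,
        ContinuousMap.add_apply]
      exact (abs_add_le _ _).trans (add_le_add (hg₁ x) (hg₂ x))
  have hsm : ∀ (c : ℝ≥0) f, c * sSup (W f) ≤ sSup (W (c • f)) := by
    intro c f
    rcases eq_or_ne c 0 with rfl | hc
    · simpa using hnn _
    have hc' : (0 : ℝ) < c := by positivity
    rw [← le_div_iff₀' hc']
    refine hub _ _ fun g hg => ?_
    rw [le_div_iff₀' hc']
    have := hle (c • f) ((c : ℝ) • g) (fun x => by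
      have := hg x
      simp only [ContinuousMap.smul_apply, CompactlySupportedContinuousMap.smul_apply,
        smul_eq_mul, abs_mul, NNReal.abs_eq, NNReal.coe_mul]
      gcongr)
    simpa using this
  refine ⟨{ toFun := fun f => ⟨sSup (W f), hnn f⟩, map_add' := ?_, map_smul' := ?_ }, ?_⟩
  · intro f₁ f₂
    exact NNReal.eq (hadd f₁ f₂)
  · intro c f
    refine NNReal.eq ?_
    change sSup (W (c • f)) = c * sSup (W f)
    refine le_antisymm ?_ (hsm c f)
    rcases eq_or_ne c 0 with rfl | hc
    · refine hub _ _ fun g hg => ?_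
      have : g = 0 := by
        ext x
        have := hg x
        simpa using this
      simp [this]
    have hc' : (0 : ℝ) < c := by positivity
    have := hsm c⁻¹ (c • f)
    rw [smul_smul, inv_mul_cancel₀ hc, one_smul, NNReal.coe_inv, inv_mul_le_iff₀ hc'] at this
    exact this
  · intro f g hg
    exact hle f g hg

open MeasureTheory in
open scoped NNReal ENNReal CompactlySupported in
lemma weak_of_pointwise {X : Type*} [TopologicalSpace X] [CompactSpace X] [T2Space X]
    (M : ℝ) (u : ℕ → C(X, ℝ)) (hu : ∀ n, ‖u n‖ ≤ M) (f : C(X, ℝ))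
    (hf : ∀ x, Tendsto (fun n => u n x) atTop (𝓝 (f x))) (L : StrongDual ℝ C(X, ℝ)) :
    Tendsto (fun n => L (u n)) atTop (𝓝 (L f)) := by
  borelize X
  obtain ⟨Λ, hΛ⟩ := exists_variation L
  let μ := NNRealRMK.rieszMeasure Λ
  have hfin : IsFiniteMeasure μ := by infer_instance
  let w : ℕ → C_c(X, ℝ≥0) := fun n =>
    CompactlySupportedContinuousMap.continuousMapEquiv
      ⟨fun x => ‖u n x - f x‖₊, by fun_prop⟩
  have hw : ∀ n x, ((w n x : ℝ≥0) : ℝ) = |u n x - f x| := fun n x => rfl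
  have hlim : Tendsto (fun n => ∫ x, ((w n x : ℝ≥0) : ℝ) ∂μ) atTop (𝓝 (∫ x, (0 : ℝ) ∂μ)) := by
    refine tendsto_integral_of_dominated_convergence (fun _ => M + ‖f‖) ?_ ?_ ?_ ?_
    · intro n
      exact (by fun_prop : Continuous fun x => ((w n x : ℝ≥0) : ℝ)).aestronglyMeasurable
    · exact integrable_const _
    · intro n
      refine Eventually.of_forall fun x => ?_
      rw [hw, Real.norm_eq_abs, abs_abs]
      exact (abs_sub _ _).trans (add_le_add (((u n).norm_coe_le_norm x).trans (hu n))
        (f.norm_coe_le_norm x))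
    · refine Eventually.of_forall fun x => ?_
      simp only [hw]
      have := ((hf x).sub_const (f x)).abs
      simpa using this
  simp only [integral_zero] at hlim
  rw [tendsto_iff_dist_tendsto_zero]
  refine squeeze_zero (fun _ => dist_nonneg) (fun n => ?_) hlim
  rw [NNRealRMK.integral_rieszMeasure, Real.dist_eq, ← map_sub, abs_le']
  refine ⟨hΛ _ _ fun x => (hw n x).ge, ?_⟩
  rw [← map_neg]
  refine hΛ _ _ fun x => ?_
  rw [hw, neg_sub, ContinuousMap.sub_apply, abs_sub_comm]

theorem stmt1 {X : Type*} [TopologicalSpace X] [CompactSpace X] [T2Space X]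
    (A : Set C(X, ℝ)) (hbdd : ∃ M : ℝ, ∀ f ∈ A, ‖f‖ ≤ M)
    (hrsc : HasRSC A) (hscp : HasSCP A) :
    IsCompact (closure (toWeakSpace ℝ C(X, ℝ) '' A)) := by
  obtain ⟨M, hM⟩ := hbdd
  refine eberlein A (isBounded_iff_forall_norm_le.2 ⟨M, hM⟩) fun u hu => ?_
  obtain ⟨φ, hφ, f, hf⟩ := hrsc u hu
  have hc := hscp (fun k => u (φ k)) (fun k => hu _) f hf
  exact ⟨φ, hφ, ⟨f, hc⟩, fun L =>
    weak_of_pointwise M (fun k => u (φ k)) (fun k => hM _ (hu _)) ⟨f, hc⟩ hf L⟩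
end

section
/- Let X be a compact Hausdorff topological space and let A be a norm-bounded subset of the Banach space C(X, ℝ). Then A is relatively weakly compact in C(X, ℝ) if and only if A has both RSC (every sequence in A has a subsequence converging pointwise to some real-valued function on X) and SCP (the pointwise limit of every pointwise convergent sequence from A is continuous). -/
open Filter Topology
set_option maxSynthPendingDepth 3

section ES
variable {E : Type*} [NormedAddCommGroup E] [NormedSpace ℝ E]

lemma es_mem_closure (S : Submodule ℝ E) (x : E)
    (hx : toWeakSpace ℝ E x ∈ closure (toWeakSpace ℝ E '' (S : Set E))) :
    x ∈ closure (S : Set E) := by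
  rw [← Convex.toWeakSpace_closure ℝ S.convex] at hx
  obtain ⟨y, hy, hyx⟩ := hx
  rwa [← (toWeakSpace ℝ E).injective hyx]

lemma es_eval_cont (f : StrongDual ℝ E) :
    Continuous fun z : WeakSpace ℝ E => f ((toWeakSpace ℝ E).symm z) :=
  WeakBilin.eval_continuous (topDualPairing ℝ E).flip f

lemma es_tendsto (u : ℕ → E) (x : E)
    (h : ∀ f : StrongDual ℝ E, Tendsto (fun n => f (u n)) atTop (𝓝 (f x))) :
    Tendsto (fun n => toWeakSpace ℝ E (u n)) atTop (𝓝 (toWeakSpace ℝ E x)) := by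
  rw [(NormedSpace.isEmbedding_inclusionInDoubleDualWeak ℝ E).tendsto_nhds_iff]
  rw [tendsto_iff_forall_eval_tendsto_topDualPairing]
  intro f
  exact h f

lemma es_norming (y : StrongDual ℝ (StrongDual ℝ E)) (hy : y ≠ 0) :
    ∃ d : StrongDual ℝ E, ‖d‖ ≤ 1 ∧ ‖y‖ < 2 * |y d| := by
  by_contra! h
  have : ‖y‖ ≤ ‖y‖ / 2 := by
    apply ContinuousLinearMap.opNorm_le_of_unit_norm (by positivity)
    intro d hd
    have := h d hd.le
    rw [Real.norm_eq_abs]; linarith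
  have := norm_pos_iff.2 hy
  linarith

lemma es_norming_fin (S : Set (StrongDual ℝ (StrongDual ℝ E))) (hS : S.Finite) :
    ∃ Q : Finset (StrongDual ℝ E), (∀ d ∈ Q, ‖d‖ ≤ 1) ∧
      ∀ y ∈ Submodule.span ℝ S, y ≠ 0 → ∃ d ∈ Q, ‖y‖ ≤ 2 * |y d| := by
  classical
  let V := Submodule.span ℝ S
  have : FiniteDimensional ℝ V := FiniteDimensional.span_of_finite ℝ hS
  have hc : IsCompact (Metric.sphere (0 : V) 1) := isCompact_sphere _ _
  obtain ⟨t, ht⟩ := hc.elim_finite_subcover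
    (fun d : {d : StrongDual ℝ E // ‖d‖ ≤ 1} =>
      {y : V | 1 < 2 * |(y : StrongDual ℝ (StrongDual ℝ E)) d.1|})
    (fun d => by
      apply isOpen_lt continuous_const
      have : Continuous fun y : V => (y : StrongDual ℝ (StrongDual ℝ E)) d.1 :=
        (ContinuousLinearMap.apply ℝ ℝ d.1).continuous.comp continuous_subtype_val
      fun_prop)
    (fun y hy => by
      have hy1 : ‖(y : StrongDual ℝ (StrongDual ℝ E))‖ = 1 := by simpa using hy
      obtain ⟨d, hd, hd'⟩ := es_norming (y : StrongDual ℝ (StrongDual ℝ E))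
        (by rw [← norm_pos_iff, hy1]; exact one_pos)
      simp only [Set.mem_iUnion]
      exact ⟨⟨d, hd⟩, by simpa [hy1] using hd'⟩)
  refine ⟨t.image Subtype.val, ?_, ?_⟩
  · intro d hd
    obtain ⟨e, -, rfl⟩ := Finset.mem_image.1 hd
    exact e.2
  · intro y hy h0
    have hpos := norm_pos_iff.2 h0
    have hmem : (‖y‖⁻¹ • (⟨y, hy⟩ : V)) ∈ Metric.sphere (0 : V) 1 := by
      simp [norm_smul, hpos.ne']
    have := ht hmem
    simp only [Set.mem_iUnion] at this
    obtain ⟨d, hd, h⟩ := this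
    refine ⟨d.1, Finset.mem_image_of_mem _ hd, ?_⟩
    simp only [Set.mem_ofPred_eq, Submodule.coe_smul, smul_apply, smul_eq_mul,
      abs_mul, abs_inv, abs_norm] at h
    have h2 : 1 < (2 * |y d.1|) / ‖y‖ := by
      rw [div_eq_inv_mul]; convert h using 1; ring
    rw [lt_div_iff₀ hpos] at h2
    linarith

/-- Eberlein-Smulian, easy part -/
lemma es_seq (A : Set E) (hA : IsCompact (closure (toWeakSpace ℝ E '' A)))
    (u : ℕ → E) (hu : ∀ n, u n ∈ A) : ∃ φ : ℕ → ℕ, StrictMono φ ∧ ∃ x : E,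
      ∀ f : StrongDual ℝ E, Tendsto (fun n => f (u (φ n))) atTop (𝓝 (f x)) := by
  let S := (Submodule.span ℝ (Set.range u))
  let T : Set E := closure (S : Set E)
  have hTsep : TopologicalSpace.IsSeparable T :=
    ((Set.countable_range u).isSeparable.span (R := ℝ)).closure
  obtain ⟨c, hc, hcT⟩ := hTsep
  have hcl : IsClosed (toWeakSpace ℝ E '' T) := by
    rw [Convex.toWeakSpace_closure ℝ S.convex]; exact isClosed_closure
  have hK : IsCompact (closure (toWeakSpace ℝ E '' A) ∩ toWeakSpace ℝ E '' T) :=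
    hA.inter_right hcl
  set K := (closure (toWeakSpace ℝ E '' A) ∩ toWeakSpace ℝ E '' T) with hKdef
  have : CompactSpace K := isCompact_iff_compactSpace.mp hK
  have huT : ∀ n, u n ∈ S := fun n => Submodule.subset_span ⟨n, rfl⟩
  have hne : c.Nonempty := by
    rw [← closure_nonempty_iff]
    exact ⟨_, hcT (subset_closure (huT 0))⟩
  obtain ⟨s, rfl⟩ := hc.exists_eq_range hne
  have hg : ∀ n, ∃ g : StrongDual ℝ E, ‖g‖ ≤ 1 ∧ g (s n) = ‖s n‖ := fun n =>
    exists_dual_vector'' ℝ (s n)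
  choose g hg1 hg2 using hg
  have hsep : ∀ x ∈ T, (∀ n, g n x = 0) → x = 0 := by
    intro x hx h0
    by_contra hne
    have hpos := norm_pos_iff.2 hne
    obtain ⟨_, ⟨n, rfl⟩, hn⟩ := Metric.mem_closure_iff.1 (hcT hx) (‖x‖/2) (by positivity)
    rw [dist_eq_norm] at hn
    have h1 : ‖s n‖ ≤ ‖x - s n‖ := by
      rw [← hg2 n]
      calc g n (s n) ≤ |g n (x - s n)| := by
            rw [map_sub, h0 n, zero_sub, abs_neg]; exact le_abs_self _
        _ ≤ 1 * ‖x - s n‖ := (g n).le_of_opNorm_le (hg1 n) _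
        _ = _ := one_mul _
    have h2 : ‖x‖ ≤ ‖x - s n‖ + ‖s n‖ := by
      simpa using norm_add_le (x - s n) (s n)
    linarith
  have hm : TopologicalSpace.MetrizableSpace K := by
    apply Metric.PiNatEmbed.TopologicalSpace.MetrizableSpace.of_countable_separating
      (fun n (k : K) => g n ((toWeakSpace ℝ E).symm k.1))
    · intro n
      exact (es_eval_cont (g n)).comp continuous_subtype_val
    · rintro ⟨x, _, x', hx', hx⟩ ⟨y, _, y', hy', hy⟩ hxy
      subst hx hy
      contrapose! hxy
      have h := hxy
      have : x' - y' = 0 := by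
        apply hsep
        · exact S.topologicalClosure.sub_mem hx' hy'
        · intro n
          have := h n
          simp only [LinearEquiv.symm_apply_apply] at this
          rw [map_sub, this, sub_self]
      rw [sub_eq_zero] at this
      simp [this]
  let _ := TopologicalSpace.metrizableSpaceMetric K
  obtain ⟨a, φ, hφ, hlim⟩ := CompactSpace.tendsto_subseq
    (fun n => (⟨toWeakSpace ℝ E (u n), subset_closure ⟨_, hu n, rfl⟩,
      ⟨_, subset_closure (huT n), rfl⟩⟩ : K))
  refine ⟨φ, hφ, (toWeakSpace ℝ E).symm a.1, fun f => ?_⟩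
  exact (((es_eval_cont f).comp continuous_subtype_val).tendsto a).comp hlim


lemma es_hard (A : Set E)
    (hseq : ∀ u : ℕ → E, (∀ n, u n ∈ A) → ∃ φ : ℕ → ℕ, StrictMono φ ∧ ∃ x : E,
      ∀ f : StrongDual ℝ E, Tendsto (fun n => f (u (φ n))) atTop (𝓝 (f x)))
    (Φ : StrongDual ℝ (StrongDual ℝ E))
    (hΦ : ∀ (Q : Finset (StrongDual ℝ E)) (ε : ℝ), 0 < ε → ∃ a ∈ A, ∀ d ∈ Q, |Φ d - d a| < ε) :
    ∃ x : E, NormedSpace.inclusionInDoubleDual ℝ E x = Φ := by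
  classical
  let J := NormedSpace.inclusionInDoubleDual ℝ E
  let V : Finset E → Submodule ℝ (StrongDual ℝ (StrongDual ℝ E)) := fun S =>
    Submodule.span ℝ (insert Φ (J '' (S : Set E)))
  have hVmono : Monotone V := fun S T h =>
    Submodule.span_mono (Set.insert_subset_insert (Set.image_mono (by exact_mod_cast h)))
  obtain ⟨s, hP, hr⟩ := exists_seq_of_forall_finset_exists
    (α := E × Finset E × Finset (StrongDual ℝ E) × ℕ)
    (fun p => p.1 ∈ A ∧ p.1 ∈ p.2.1 ∧ (∀ d ∈ p.2.2.1, ‖d‖ ≤ 1) ∧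
      ∀ y ∈ V p.2.1, y ≠ 0 → ∃ d ∈ p.2.2.1, ‖y‖ ≤ 2 * |y d|)
    (fun p q => p.2.1 ⊆ q.2.1 ∧ p.2.2.2 < q.2.2.2 ∧
      ∀ d ∈ p.2.2.1, |Φ d - d q.1| < 1 / ((q.2.2.2 : ℝ) + 1))
    (fun t _ => by
      let k := t.sup (fun p => p.2.2.2) + 1
      obtain ⟨a, haA, ha⟩ := hΦ (t.biUnion fun p => p.2.2.1) (1 / ((k : ℝ) + 1)) (by positivity)
      let S := insert a (t.biUnion fun p => p.2.1)
      obtain ⟨Q, hQ1, hQ2⟩ := es_norming_fin (insert Φ (J '' (S : Set E)))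
        ((S.finite_toSet.image _).insert _)
      refine ⟨(a, S, Q, k), ⟨haA, Finset.mem_insert_self _ _, hQ1, hQ2⟩, fun p hp => ⟨?_, ?_, ?_⟩⟩
      · exact (Finset.subset_biUnion_of_mem (fun p => p.2.1) hp).trans (Finset.subset_insert _ _)
      · exact Nat.lt_succ_of_le (Finset.le_sup (f := fun p => p.2.2.2) hp)
      · intro d hd
        exact ha d (Finset.mem_biUnion.2 ⟨p, hp, hd⟩))
  obtain ⟨φ, hφ, x, hx⟩ := hseq (fun n => (s n).1) (fun n => (hP n).1)
  refine ⟨x, ?_⟩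
  have hk : StrictMono fun n => (s n).2.2.2 := fun m n h => (hr m n h).2.1
  have hSmono : Monotone fun n => V (s n).2.1 := by
    intro m n h
    rcases h.eq_or_lt with rfl | h
    · exact le_rfl
    · exact hVmono (hr m n h).1
  -- the difference vanishes on all the norming functionals
  have hzero : ∀ n, ∀ d ∈ (s n).2.2.1, (Φ - J x) d = 0 := by
    intro n d hd
    have h1 : Tendsto (fun m => d (s m).1) atTop (𝓝 (Φ d)) := by
      rw [tendsto_iff_norm_sub_tendsto_zero]
      refine squeeze_zero' (Eventually.of_forall fun _ => norm_nonneg _) ?_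
        ((tendsto_one_div_add_atTop_nhds_zero_nat (𝕜 := ℝ)).comp hk.tendsto_atTop)
      filter_upwards [eventually_gt_atTop n] with m hm
      rw [norm_sub_rev]
      exact ((hr n m hm).2.2 d hd).le
    have h2 := tendsto_nhds_unique (h1.comp hφ.tendsto_atTop) (hx d)
    change Φ d - d x = 0
    rw [h2, sub_self]
  have hxcl : x ∈ closure (Submodule.span ℝ (Set.range fun n => (s n).1) : Set E) := by
    apply es_mem_closure
    apply mem_closure_of_tendsto (es_tendsto _ x hx)
    exact Eventually.of_forall fun n => ⟨_, Submodule.subset_span ⟨φ n, rfl⟩, rfl⟩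
  have hspan : ∀ e ∈ Submodule.span ℝ (Set.range fun n => (s n).1),
      ∃ n, Φ - J e ∈ V (s n).2.1 := by
    intro e he
    have : ∃ n, J e ∈ V (s n).2.1 := by
      induction he using Submodule.span_induction with
      | mem e he =>
        obtain ⟨n, rfl⟩ := he
        exact ⟨n, Submodule.subset_span (Or.inr ⟨_, (hP n).2.1, rfl⟩)⟩
      | zero => exact ⟨0, by rw [map_zero]; exact zero_mem _⟩
      | add a b _ _ ha hb =>
        obtain ⟨m, hm⟩ := ha
        obtain ⟨n, hn⟩ := hb
        refine ⟨max m n, ?_⟩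
        rw [map_add]
        exact add_mem (hSmono (le_max_left _ _) hm) (hSmono (le_max_right _ _) hn)
      | smul c a _ ha =>
        obtain ⟨m, hm⟩ := ha
        refine ⟨m, ?_⟩
        rw [map_smul]
        exact Submodule.smul_mem _ _ hm
    obtain ⟨n, hn⟩ := this
    exact ⟨n, sub_mem (Submodule.subset_span (Or.inl rfl)) hn⟩
  by_contra hne
  have hne' : Φ - J x ≠ 0 := fun h => hne (sub_eq_zero.1 h).symm
  have hpos := norm_pos_iff.2 hne'
  obtain ⟨e, he, hxe⟩ := Metric.mem_closure_iff.1 hxcl (‖Φ - J x‖ / 4) (by positivity)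
  rw [dist_eq_norm] at hxe
  obtain ⟨n, hn⟩ := hspan e he
  have hJ : ‖J (x - e)‖ ≤ ‖x - e‖ := NormedSpace.double_dual_bound ℝ E _
  have hdec : Φ - J e = (Φ - J x) + J (x - e) := by rw [map_sub]; abel
  have hw : ‖Φ - J e‖ ≤ 2 * ‖x - e‖ := by
    by_cases h0 : Φ - J e = 0
    · rw [h0, norm_zero]; positivity
    obtain ⟨d, hd, hle⟩ := (hP n).2.2.2 _ hn h0
    have h1 : (Φ - J e) d = J (x - e) d := by
      rw [hdec, add_apply, hzero n d hd, zero_add]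
    rw [h1] at hle
    have h2 : |J (x - e) d| ≤ ‖J (x - e)‖ := by
      have := (J (x - e)).le_opNorm_of_le ((hP n).2.2.1 d hd)
      simpa using this
    linarith
  have h3 : ‖Φ - J x‖ ≤ ‖Φ - J e‖ + ‖J (x - e)‖ := by
    have : Φ - J x = (Φ - J e) - J (x - e) := by rw [hdec]; abel
    rw [this]; exact norm_sub_le _ _
  linarith

lemma es_compact (A : Set E) (M : ℝ) (hM : ∀ f ∈ A, ‖f‖ ≤ M)
    (hseq : ∀ u : ℕ → E, (∀ n, u n ∈ A) → ∃ φ : ℕ → ℕ, StrictMono φ ∧ ∃ x : E,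
      ∀ f : StrongDual ℝ E, Tendsto (fun n => f (u (φ n))) atTop (𝓝 (f x))) :
    IsCompact (closure (toWeakSpace ℝ E '' A)) := by
  apply NormedSpace.isCompact_closure_of_isBounded
  · rw [Set.preimage_image_eq _ (toWeakSpace ℝ E).injective]
    exact isBounded_iff_forall_norm_le.2 ⟨M, hM⟩
  · intro Ψ hΨ
    obtain ⟨x, hx⟩ := es_hard A hseq (WeakDual.toStrongDual Ψ) (by
      intro Q ε hε
      let U : Set (WeakDual ℝ (StrongDual ℝ E)) := ⋂ d ∈ Q, {z | |Ψ d - z d| < ε}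
      have hU : IsOpen U := by
        apply isOpen_biInter_finset
        intro d _
        exact isOpen_lt ((continuous_const.sub (WeakDual.eval_continuous d)).abs) continuous_const
      obtain ⟨z, hzU, ⟨_, ⟨a, ha, rfl⟩, rfl⟩⟩ := mem_closure_iff.1 hΨ U hU
        (by simp [U, hε])
      refine ⟨a, ha, fun d hd => ?_⟩
      exact Set.mem_iInter₂.1 hzU d hd)
    exact ⟨toWeakSpace ℝ E x, by rw [← WeakDual.toWeakDual_toStrongDual Ψ, ← hx]; rfl⟩

end ES

section RZ
open MeasureTheory NNReal
open scoped CompactlySupported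
variable {X : Type*} [TopologicalSpace X] [CompactSpace X] [T2Space X]

/-- values of `φ` on functions dominated by `f` -/
def rzSet (φ : StrongDual ℝ C(X, ℝ)) (f : C_c(X, ℝ≥0)) : Set ℝ :=
  {r | ∃ g : C(X, ℝ), (∀ x, |g x| ≤ f x) ∧ φ g = r}

lemma rzSet_bdd (φ : StrongDual ℝ C(X, ℝ)) (f : C_c(X, ℝ≥0)) : BddAbove (rzSet φ f) := by
  obtain ⟨C, hC⟩ := (isCompact_range (f.continuous)).bddAbove
  refine ⟨‖φ‖ * C, ?_⟩
  rintro r ⟨g, hg, rfl⟩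
  have : ‖g‖ ≤ C := by
    refine (ContinuousMap.norm_le g C.2).2 ?_
    intro x
    exact (hg x).trans (by exact_mod_cast hC ⟨x, rfl⟩)
  calc φ g ≤ ‖φ g‖ := le_abs_self _
    _ ≤ ‖φ‖ * ‖g‖ := φ.le_opNorm g
    _ ≤ _ := by gcongr

lemma rzSet_zero (φ : StrongDual ℝ C(X, ℝ)) (f : C_c(X, ℝ≥0)) : (0 : ℝ) ∈ rzSet φ f :=
  ⟨0, by simp, by simp⟩

lemma rz_nonneg (φ : StrongDual ℝ C(X, ℝ)) (f : C_c(X, ℝ≥0)) : 0 ≤ sSup (rzSet φ f) :=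
  le_csSup (rzSet_bdd φ f) (rzSet_zero φ f)

lemma rz_add (φ : StrongDual ℝ C(X, ℝ)) (f f' : C_c(X, ℝ≥0)) :
    sSup (rzSet φ (f + f')) = sSup (rzSet φ f) + sSup (rzSet φ f') := by
  apply le_antisymm
  · apply csSup_le ⟨0, rzSet_zero φ _⟩
    rintro r ⟨g, hg, rfl⟩
    let F : C(X, ℝ) := ⟨fun x => (f x : ℝ), by fun_prop⟩
    let g1 : C(X, ℝ) := (g ⊓ F) ⊔ (-F)
    have h1 : φ g1 ∈ rzSet φ f := by
      refine ⟨g1, fun x => ?_, rfl⟩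
      have := (f x).2
      simp only [g1, F, ContinuousMap.sup_apply, ContinuousMap.inf_apply, ContinuousMap.neg_apply,
        ContinuousMap.coe_mk, abs_le]
      refine ⟨le_sup_right, sup_le inf_le_right ?_⟩
      have : (0:ℝ) ≤ f x := (f x).2
      linarith
    have h2 : φ (g - g1) ∈ rzSet φ f' := by
      refine ⟨g - g1, fun x => ?_, rfl⟩
      have h0 := (f x).2
      have h0' := (f' x).2
      have := hg x
      simp only [g1, F, ContinuousMap.sup_apply, ContinuousMap.inf_apply, ContinuousMap.neg_apply,
        ContinuousMap.sub_apply, ContinuousMap.coe_mk, abs_le,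
        CompactlySupportedContinuousMap.add_apply, NNReal.coe_add] at this ⊢
      rcases le_total (g x) (f x : ℝ) with h | h
      · rw [inf_eq_left.2 h]
        rcases le_total (g x) (-(f x : ℝ)) with h' | h'
        · rw [sup_eq_right.2 h']
          constructor <;> linarith
        · rw [sup_eq_left.2 h']
          constructor <;> linarith
      · rw [inf_eq_right.2 h, sup_eq_left.2 (by linarith)]
        constructor <;> linarith
    calc φ g = φ g1 + φ (g - g1) := by rw [← map_add]; simp
      _ ≤ _ := add_le_add (le_csSup (rzSet_bdd φ f) h1) (le_csSup (rzSet_bdd φ f') h2)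
  · rw [← le_sub_iff_add_le]
    apply csSup_le ⟨0, rzSet_zero φ _⟩
    rintro r ⟨g, hg, rfl⟩
    rw [le_sub_comm]
    apply csSup_le ⟨0, rzSet_zero φ _⟩
    rintro r ⟨g', hg', rfl⟩
    rw [le_sub_iff_add_le]
    apply le_csSup (rzSet_bdd φ _)
    refine ⟨g' + g, fun x => ?_, by simp⟩
    have := abs_add_le (g' x) (g x)
    have := hg x
    have := hg' x
    simp only [ContinuousMap.add_apply, CompactlySupportedContinuousMap.add_apply, NNReal.coe_add]
    linarith

lemma rz_smul_le (φ : StrongDual ℝ C(X, ℝ)) (c : ℝ≥0) (f : C_c(X, ℝ≥0)) :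
    c * sSup (rzSet φ f) ≤ sSup (rzSet φ (c • f)) := by
  rcases eq_or_ne c 0 with rfl | hc
  · simpa using rz_nonneg φ _
  have hc' : (0:ℝ) < c := by exact_mod_cast pos_iff_ne_zero.2 hc
  rw [← le_div_iff₀' hc']
  apply csSup_le ⟨0, rzSet_zero φ _⟩
  rintro r ⟨g, hg, rfl⟩
  rw [le_div_iff₀' hc']
  apply le_csSup (rzSet_bdd φ _)
  refine ⟨(c : ℝ) • g, fun x => ?_, by simp⟩
  simp only [ContinuousMap.smul_apply, smul_eq_mul, abs_mul, NNReal.abs_eq,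
    CompactlySupportedContinuousMap.smul_apply, NNReal.coe_mul]
  have := hg x
  gcongr

lemma rz_smul (φ : StrongDual ℝ C(X, ℝ)) (c : ℝ≥0) (f : C_c(X, ℝ≥0)) :
    sSup (rzSet φ (c • f)) = c * sSup (rzSet φ f) := by
  apply le_antisymm _ (rz_smul_le φ c f)
  rcases eq_or_ne c 0 with rfl | hc
  · simp only [zero_smul, NNReal.coe_zero, zero_mul]
    apply csSup_le ⟨0, rzSet_zero φ _⟩
    rintro r ⟨g, hg, rfl⟩
    have : g = 0 := by
      ext x; simpa using hg x
    simp [this]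
  have hc' : (0:ℝ) < c := by exact_mod_cast pos_iff_ne_zero.2 hc
  have := rz_smul_le φ c⁻¹ (c • f)
  rw [smul_smul, inv_mul_cancel₀ hc, one_smul] at this
  rw [NNReal.coe_inv, inv_mul_le_iff₀ hc'] at this
  exact this

/-- The total variation functional. -/
noncomputable def rzLin (φ : StrongDual ℝ C(X, ℝ)) : C_c(X, ℝ≥0) →ₗ[ℝ≥0] ℝ≥0 where
  toFun f := ⟨sSup (rzSet φ f), rz_nonneg φ f⟩
  map_add' f g := by
    apply NNReal.eq; exact rz_add φ f g
  map_smul' c f := by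
    apply NNReal.eq; exact rz_smul φ c f

lemma rz_measure (φ : StrongDual ℝ C(X, ℝ)) [MeasurableSpace X] [BorelSpace X] :
    ∃ μ : Measure X, IsFiniteMeasure μ ∧ ∀ g : C(X, ℝ), |φ g| ≤ ∫ x, |g x| ∂μ := by
  refine ⟨NNRealRMK.rieszMeasure (rzLin φ), inferInstance, fun g => ?_⟩
  let f : C_c(X, ℝ≥0) := CompactlySupportedContinuousMap.continuousMapEquiv
    (⟨fun x => ‖g x‖₊, by fun_prop⟩ : C(X, ℝ≥0))
  have h := NNRealRMK.integral_rieszMeasure (rzLin φ) f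
  have hf : ∀ x, (f x : ℝ) = |g x| := fun x => rfl
  simp only [hf] at h
  rw [h]
  change |φ g| ≤ sSup (rzSet φ f)
  rw [abs_le', ← map_neg]
  constructor
  · exact le_csSup (rzSet_bdd φ f) ⟨g, fun x => (hf x).ge, rfl⟩
  · exact le_csSup (rzSet_bdd φ f) ⟨-g, fun x => by simp [hf], rfl⟩

lemma rz_weak (u : ℕ → C(X, ℝ)) (M : ℝ) (hM : ∀ n, ‖u n‖ ≤ M) (f : C(X, ℝ))
    (hf : ∀ x, Tendsto (fun n => u n x) atTop (𝓝 (f x))) (φ : StrongDual ℝ C(X, ℝ)) :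
    Tendsto (fun n => φ (u n)) atTop (𝓝 (φ f)) := by
  borelize X
  obtain ⟨μ, hμ, h⟩ := rz_measure φ
  have hlim : Tendsto (fun n => ∫ x, |(u n - f) x| ∂μ) atTop (𝓝 (∫ x, (0:ℝ) ∂μ)) := by
    apply tendsto_integral_of_dominated_convergence (fun _ => M + ‖f‖)
    · intro n
      exact (u n - f).continuous.abs.aestronglyMeasurable_of_compactSpace
    · exact integrable_const _
    · intro n
      refine Eventually.of_forall fun x => ?_
      rw [Real.norm_eq_abs, abs_abs, ← Real.norm_eq_abs]
      calc ‖(u n - f) x‖ ≤ ‖u n - f‖ := ContinuousMap.norm_coe_le_norm _ x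
        _ ≤ ‖u n‖ + ‖f‖ := norm_sub_le _ _
        _ ≤ _ := by gcongr; exact hM n
    · refine Eventually.of_forall fun x => ?_
      have := ((hf x).sub_const (f x)).abs
      simpa using this
  rw [integral_zero] at hlim
  rw [tendsto_iff_norm_sub_tendsto_zero]
  refine squeeze_zero (fun _ => norm_nonneg _) (fun n => ?_) hlim
  rw [← map_sub]
  exact h _
end RZ

theorem stmt2 {X : Type*} [TopologicalSpace X] [CompactSpace X] [T2Space X]
    (A : Set C(X, ℝ)) (hbdd : ∃ M : ℝ, ∀ f ∈ A, ‖f‖ ≤ M) :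
    IsCompact (closure (toWeakSpace ℝ C(X, ℝ) '' A)) ↔ HasRSC A ∧ HasSCP A := by
  obtain ⟨M, hM⟩ := hbdd
  constructor
  · intro h
    have key : ∀ u : ℕ → C(X, ℝ), (∀ n, u n ∈ A) → ∃ φ : ℕ → ℕ, StrictMono φ ∧
        ∃ f : C(X, ℝ), ∀ x, Tendsto (fun k => u (φ k) x) atTop (𝓝 (f x)) := by
      intro u hu
      obtain ⟨φ, hφ, f, hf⟩ := es_seq A h u hu
      exact ⟨φ, hφ, f, fun x => hf (ContinuousMap.evalCLM ℝ x)⟩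
    constructor
    · intro u hu
      obtain ⟨φ, hφ, f, hf⟩ := key u hu
      exact ⟨φ, hφ, f, hf⟩
    · intro u hu f hf
      obtain ⟨φ, hφ, g, hg⟩ := key u hu
      have : f = g := funext fun x =>
        tendsto_nhds_unique ((hf x).comp hφ.tendsto_atTop) (hg x)
      rw [this]
      exact g.continuous
  · rintro ⟨h1, h2⟩
    apply es_compact A M hM
    intro u hu
    obtain ⟨φ, hφ, f, hf⟩ := h1 u hu
    have hc := h2 (fun k => u (φ k)) (fun k => hu _) f hf
    exact ⟨φ, hφ, ⟨f, hc⟩, rz_weak (fun k => u (φ k)) M (fun k => hM _ (hu _)) ⟨f, hc⟩ hf⟩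
end
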